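/- Let n ≥ 4, let i ∈ ℤ/nℤ, and let E be a set of diagonals of the convex n-gon with e_i ∈ E. Let δ : (ℤ/nℤ)∖{i} → ℤ/(n−1)ℤ be the unique cyclic-order-preserving bijection sending i+1, i+2, …, i−1 to 0, 1, …, n−2, and let E′ be the set of diagonals of the convex (n−1)-gon of the form {δ(a), δ(b)} with {a,b} ∈ E, i ∉ {a,b}, and {δ(a), δ(b)} a diagonal of the (n−1)-gon. Then the number of triangulations of the convex n-gon that are contained in E and contain e_i equals the number of triangulations of the convex (n−1)-gon contained in E′. Consequently, the total number of triangulations contained in E equals the number of triangulations of the (n−1)-gon contained in E′ plus the number of triangulations contained in E∖{e_i}. -/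

import Mathlib

/-- `x` lies strictly inside the (clockwise) open arc from `a` to `b` on the convex `n`-gon
whose vertices are identified with `ZMod n` in cyclic order. -/
def Between (n : ℕ) (a x b : ZMod n) : Prop :=
  0 < (x - a).val ∧ (x - a).val < (b - a).val

/-- A diagonal of the convex `n`-gon: an unordered pair of distinct, non cyclically adjacent
vertices. -/
def IsDiagonal (n : ℕ) (p : Sym2 (ZMod n)) : Prop :=
  ∃ a b : ZMod n, p = s(a, b) ∧ a ≠ b ∧ b ≠ a + 1 ∧ b ≠ a - 1

/-- Two diagonals cross iff their endpoints interleave in cyclic order: for some labelings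
`p = {a,b}`, `q = {c,d}`, the vertex `c` lies strictly inside the arc from `a` to `b` and
`d` lies strictly inside the arc from `b` to `a`. -/
def Cross (n : ℕ) (p q : Sym2 (ZMod n)) : Prop :=
  ∃ a b c d : ZMod n, p = s(a, b) ∧ q = s(c, d) ∧ Between n a c b ∧ Between n b d a

/-- A triangulation of the convex `n`-gon: a set of `n − 3` pairwise non-crossing diagonals. -/
def IsTriangulation (n : ℕ) (T : Finset (Sym2 (ZMod n))) : Prop :=
  T.card = n - 3 ∧ (∀ p ∈ T, IsDiagonal n p) ∧
    ∀ p ∈ T, ∀ q ∈ T, p ≠ q → ¬ Cross n p q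

/-- The span-2 diagonal `e_i = {i−1, i+1}`. -/
def spanTwo (n : ℕ) (i : ZMod n) : Sym2 (ZMod n) := s(i - 1, i + 1)

/-- `T(n,m)`: the number of triangulations of the convex `n`-gon containing none of the span-2
diagonals `e_1, …, e_m`. -/
noncomputable def Tcount (n m : ℕ) : ℕ :=
  Set.ncard {T : Finset (Sym2 (ZMod n)) |
    IsTriangulation n T ∧ ∀ k : ℕ, 1 ≤ k → k ≤ m → spanTwo n (k : ZMod n) ∉ T}

/-- The unique cyclic-order-preserving bijection from `(ZMod n) ∖ {i}` to `ZMod (n−1)` sending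
`i+1, i+2, …, i−1` to `0, 1, …, n−2`. -/
def contractMap (n : ℕ) (i : ZMod n) : ZMod n → ZMod (n - 1) :=
  fun v => (((v - i).val - 1 : ℕ) : ZMod (n - 1))

/-- The image set of diagonals: pairs `{δ a, δ b}` with `{a,b} ∈ E`, `i ∉ {a,b}`, that are
diagonals of the convex `(n−1)`-gon. -/
def contractEdges (n : ℕ) (i : ZMod n) (E : Set (Sym2 (ZMod n))) :
    Set (Sym2 (ZMod (n - 1))) :=
  {q | ∃ a b : ZMod n, s(a, b) ∈ E ∧ a ≠ i ∧ b ≠ i ∧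
    q = s(contractMap n i a, contractMap n i b) ∧ IsDiagonal (n - 1) q}

theorem val_sub_eq_ite (n : ℕ) [NeZero n] (a b : ZMod n) :
    (a - b).val = if b.val ≤ a.val then a.val - b.val else a.val + n - b.val := by
  split_ifs with h
  · exact ZMod.val_sub h
  · have h1 : (b - a).val = b.val - a.val := ZMod.val_sub (by omega)
    have h2 : b - a ≠ 0 := fun h0 => by rw [h0, ZMod.val_zero] at h1; omega
    have : NeZero (b - a) := ⟨h2⟩
    have h3 := ZMod.val_neg_of_ne_zero (b - a)
    rw [neg_sub] at h3
    have := ZMod.val_lt b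
    omega

theorem val_sub_injective (n : ℕ) [NeZero n] (i : ZMod n) :
    Function.Injective fun a : ZMod n => (a - i).val :=
  (ZMod.val_injective n).comp (sub_left_injective (b := i))

/-- Betweenness in terms of the positions of the vertices counted from `i`. -/
theorem between_iff (n : ℕ) [NeZero n] (i a x b : ZMod n) :
    Between n a x b ↔
      ((a - i).val < (x - i).val ∧ (x - i).val < (b - i).val) ∨
      ((x - i).val < (b - i).val ∧ (b - i).val < (a - i).val) ∨
      ((b - i).val < (a - i).val ∧ (a - i).val < (x - i).val) := by
  have h1 := val_sub_eq_ite n (x - i) (a - i)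
  have h2 := val_sub_eq_ite n (b - i) (a - i)
  rw [sub_sub_sub_cancel_right] at h1 h2
  have := ZMod.val_lt (a - i)
  have := ZMod.val_lt (x - i)
  have := ZMod.val_lt (b - i)
  unfold Between
  rw [h1, h2]
  split_ifs <;> omega

/-- Adjacency in terms of the positions of the vertices counted from `i`. -/
theorem eq_add_one_iff (n : ℕ) [NeZero n] (hn : 2 ≤ n) (i a b : ZMod n) :
    b = a + 1 ↔ (b - i).val = (a - i).val + 1 ∨ ((b - i).val = 0 ∧ (a - i).val + 1 = n) := by
  have : Fact (1 < n) := ⟨hn⟩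
  have hab : b = a + 1 ↔ (b - a).val = 1 := by
    rw [← ZMod.val_one n, (ZMod.val_injective n).eq_iff, sub_eq_iff_eq_add, add_comm]
  have h := val_sub_eq_ite n (b - i) (a - i)
  rw [sub_sub_sub_cancel_right] at h
  have := ZMod.val_lt (a - i)
  have := ZMod.val_lt (b - i)
  rw [hab, h]
  split_ifs <;> omega

/-- Diagonals in terms of the positions of the vertices counted from `i`. -/
theorem isDiagonal_mk_iff (n : ℕ) [NeZero n] (hn : 2 ≤ n) (i a b : ZMod n) :
    IsDiagonal n s(a, b) ↔
      ((a - i).val + 2 ≤ (b - i).val ∧ (b - i).val + 2 ≤ (a - i).val + n) ∨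
      ((b - i).val + 2 ≤ (a - i).val ∧ (a - i).val + 2 ≤ (b - i).val + n) := by
  have key : IsDiagonal n s(a, b) ↔ a ≠ b ∧ b ≠ a + 1 ∧ a ≠ b + 1 := by
    simp only [IsDiagonal, Ne, eq_sub_iff_add_eq]
    constructor
    · rintro ⟨c, d, h, h1, h2, h3⟩
      rcases Sym2.eq_iff.1 h with ⟨rfl, rfl⟩ | ⟨rfl, rfl⟩
      · exact ⟨h1, h2, fun h => h3 h.symm⟩
      · exact ⟨fun h => h1 h.symm, fun h => h3 h.symm, h2⟩
    · rintro ⟨h1, h2, h3⟩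
      exact ⟨a, b, rfl, h1, h2, fun h => h3 h.symm⟩
  have hab : a = b ↔ (a - i).val = (b - i).val := (val_sub_injective n i).eq_iff.symm
  rw [key, Ne, Ne, Ne, hab, eq_add_one_iff n hn i, eq_add_one_iff n hn i]
  have := ZMod.val_lt (a - i)
  have := ZMod.val_lt (b - i)
  omega

theorem cross_mk_iff (n : ℕ) (a b c d : ZMod n) :
    Cross n s(a, b) s(c, d) ↔
      (Between n a c b ∧ Between n b d a) ∨ (Between n a d b ∧ Between n b c a) := by
  constructor
  · rintro ⟨a', b', c', d', h, h', h1, h2⟩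
    rcases Sym2.eq_iff.1 h with ⟨rfl, rfl⟩ | ⟨rfl, rfl⟩ <;>
      rcases Sym2.eq_iff.1 h' with ⟨rfl, rfl⟩ | ⟨rfl, rfl⟩ <;> tauto
  · rintro (⟨h1, h2⟩ | ⟨h1, h2⟩)
    · exact ⟨a, b, c, d, rfl, rfl, h1, h2⟩
    · exact ⟨a, b, d, c, rfl, Sym2.eq_swap, h1, h2⟩

/-- The embedding of the `m`-gon into the `(m+1)`-gon that skips the vertex `i`; it is inverse to
`contractMap (m + 1) i`. -/
def expandMap (m : ℕ) (i : ZMod (m + 1)) (v : ZMod m) : ZMod (m + 1) :=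
  i + ((v.val + 1 : ℕ) : ZMod (m + 1))

section expandMap

variable {m : ℕ} (i : ZMod (m + 1))

theorem val_spanTwo_left : (i - 1 - i).val = m := by
  rw [sub_sub_cancel_left, ZMod.val_neg_one]

theorem val_spanTwo_right (hm : 3 ≤ m) : (i + 1 - i).val = 1 := by
  have : Fact (1 < m + 1) := ⟨by omega⟩
  rw [add_sub_cancel_left, ZMod.val_one]

theorem cross_spanTwo_of_mem (hm : 3 ≤ m) {p : Sym2 (ZMod (m + 1))} (hp : IsDiagonal (m + 1) p)
    (hi : i ∈ p) : Cross (m + 1) (spanTwo (m + 1) i) p := by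
  obtain ⟨c, rfl⟩ := hi
  rw [isDiagonal_mk_iff (m + 1) (by omega) i] at hp
  simp only [spanTwo, cross_mk_iff, between_iff (m + 1) i, val_spanTwo_left,
    val_spanTwo_right i hm]
  simp only [sub_self, ZMod.val_zero] at hp ⊢
  omega

theorem isDiagonal_spanTwo (hm : 3 ≤ m) : IsDiagonal (m + 1) (spanTwo (m + 1) i) := by
  rw [spanTwo, isDiagonal_mk_iff (m + 1) (by omega) i, val_spanTwo_left, val_spanTwo_right i hm]
  omega

variable [NeZero m]

theorem val_expandMap_sub (v : ZMod m) : (expandMap m i v - i).val = v.val + 1 := by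
  have := ZMod.val_lt v
  rw [expandMap, add_sub_cancel_left, ZMod.val_natCast_of_lt (by omega)]

theorem expandMap_injective : Function.Injective (expandMap m i) := by
  intro v w h
  have hv := val_expandMap_sub i v
  rw [h, val_expandMap_sub] at hv
  exact ZMod.val_injective m (by omega)

theorem expandMap_ne (v : ZMod m) : expandMap m i v ≠ i := by
  intro h
  have hv := val_expandMap_sub i v
  rw [h, sub_self, ZMod.val_zero] at hv
  omega

theorem contractMap_expandMap (v : ZMod m) : contractMap (m + 1) i (expandMap m i v) = v := by
  change (((expandMap m i v - i).val - 1 : ℕ) : ZMod m) = v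
  rw [val_expandMap_sub, Nat.add_sub_cancel, ZMod.natCast_zmod_val]

theorem exists_expandMap_eq {a : ZMod (m + 1)} (ha : a ≠ i) : ∃ v, expandMap m i v = a := by
  have h0 : (a - i).val ≠ 0 := by rwa [Ne, ZMod.val_eq_zero, sub_eq_zero]
  have := ZMod.val_lt (a - i)
  refine ⟨((a - i).val - 1 : ℕ), val_sub_injective (m + 1) i ?_⟩
  change (expandMap m i _ - i).val = (a - i).val
  rw [val_expandMap_sub, ZMod.val_natCast_of_lt (by omega)]
  omega

theorem between_expandMap_iff (a x b : ZMod m) :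
    Between (m + 1) (expandMap m i a) (expandMap m i x) (expandMap m i b) ↔ Between m a x b := by
  rw [between_iff (m + 1) i, between_iff m 0]
  simp only [val_expandMap_sub, sub_zero]
  omega

theorem cross_map_expandMap_iff (p q : Sym2 (ZMod m)) :
    Cross (m + 1) (p.map (expandMap m i)) (q.map (expandMap m i)) ↔ Cross m p q := by
  induction p with | _ a b
  induction q with | _ c d
  simp only [Sym2.map_mk, cross_mk_iff, between_expandMap_iff]

theorem isDiagonal_iff_map_expandMap (hm : 3 ≤ m) (q : Sym2 (ZMod m)) :
    IsDiagonal m q ↔ IsDiagonal (m + 1) (q.map (expandMap m i)) ∧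
      q.map (expandMap m i) ≠ spanTwo (m + 1) i := by
  induction q with | _ a b
  rw [Sym2.map_mk, isDiagonal_mk_iff m (by omega) 0, isDiagonal_mk_iff (m + 1) (by omega) i,
    spanTwo, Ne, Sym2.eq_iff]
  simp only [← (val_sub_injective (m + 1) i).eq_iff, val_expandMap_sub, val_spanTwo_left,
    val_spanTwo_right i hm, sub_zero]
  have := ZMod.val_lt a
  have := ZMod.val_lt b
  omega

theorem not_cross_spanTwo_map_expandMap (hm : 3 ≤ m) (q : Sym2 (ZMod m)) :
    ¬ Cross (m + 1) (spanTwo (m + 1) i) (q.map (expandMap m i)) ∧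
      ¬ Cross (m + 1) (q.map (expandMap m i)) (spanTwo (m + 1) i) := by
  induction q with | _ a b
  rw [Sym2.map_mk, spanTwo]
  simp only [cross_mk_iff, between_iff (m + 1) i, val_expandMap_sub, val_spanTwo_left,
    val_spanTwo_right i hm]
  have := ZMod.val_lt a
  have := ZMod.val_lt b
  omega

theorem exists_map_expandMap_eq {p : Sym2 (ZMod (m + 1))} (hi : i ∉ p) :
    ∃ q : Sym2 (ZMod m), q.map (expandMap m i) = p := by
  induction p with | _ a b
  simp only [Sym2.mem_iff, not_or] at hi
  obtain ⟨v, rfl⟩ := exists_expandMap_eq i (Ne.symm hi.1)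
  obtain ⟨w, rfl⟩ := exists_expandMap_eq i (Ne.symm hi.2)
  exact ⟨s(v, w), rfl⟩

theorem mem_contractEdges_iff (E : Set (Sym2 (ZMod (m + 1)))) (q : Sym2 (ZMod m)) :
    q ∈ (contractEdges (m + 1) i E : Set (Sym2 (ZMod m))) ↔
      q.map (expandMap m i) ∈ E ∧ IsDiagonal m q := by
  constructor
  · rintro ⟨a, b, hab, ha, hb, hq, hd⟩
    obtain ⟨v, rfl⟩ := exists_expandMap_eq i ha
    obtain ⟨w, rfl⟩ := exists_expandMap_eq i hb
    rw [contractMap_expandMap, contractMap_expandMap] at hq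
    refine ⟨?_, hd⟩
    rw [hq]
    exact hab
  · rintro ⟨hE, hd⟩
    induction q with | _ v w
    refine ⟨_, _, hE, expandMap_ne i v, expandMap_ne i w, ?_, hd⟩
    rw [contractMap_expandMap, contractMap_expandMap]
    rfl

/-- Add the vertex `i` to the `m`-gon by gluing a triangle along the edge that becomes `e_i`. -/
def expandDiagonals (T : Finset (Sym2 (ZMod m))) : Finset (Sym2 (ZMod (m + 1))) :=
  insert (spanTwo (m + 1) i) (T.image (Sym2.map (expandMap m i)))

theorem spanTwo_notMem_image (hm : 3 ≤ m) {T : Finset (Sym2 (ZMod m))}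
    (hT : ∀ q ∈ T, IsDiagonal m q) :
    spanTwo (m + 1) i ∉ T.image (Sym2.map (expandMap m i)) := by
  intro h
  obtain ⟨q, hq, hqe⟩ := Finset.mem_image.1 h
  exact ((isDiagonal_iff_map_expandMap i hm q).1 (hT q hq)).2 hqe

theorem isTriangulation_expandDiagonals_iff (hm : 3 ≤ m) {T : Finset (Sym2 (ZMod m))}
    (hT : ∀ q ∈ T, IsDiagonal m q) :
    IsTriangulation (m + 1) (expandDiagonals i T) ↔ IsTriangulation m T := by
  have hinj := Sym2.map.injective (expandMap_injective (m := m) i)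
  have hcard : (expandDiagonals i T).card = T.card + 1 := by
    rw [expandDiagonals, Finset.card_insert_of_notMem (spanTwo_notMem_image i hm hT),
      Finset.card_image_of_injective _ hinj]
  have hcard' : T.card + 1 = m + 1 - 3 ↔ T.card = m - 3 := by omega
  unfold IsTriangulation
  rw [hcard, hcard']
  simp only [expandDiagonals, Finset.forall_mem_insert, Finset.forall_mem_image,
    cross_map_expandMap_iff, hinj.ne_iff]
  have hc := not_cross_spanTwo_map_expandMap i hm
  have hd : ∀ q ∈ T, IsDiagonal (m + 1) (q.map (expandMap m i)) := fun q hq =>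
    ((isDiagonal_iff_map_expandMap i hm q).1 (hT q hq)).1
  constructor
  · rintro ⟨h1, -, -, h2⟩
    exact ⟨h1, hT, fun p hp => (h2 hp).2⟩
  · rintro ⟨h1, -, h2⟩
    exact ⟨h1, ⟨isDiagonal_spanTwo i hm, hd⟩, ⟨fun h => absurd rfl h, fun q _ _ => (hc q).1⟩,
      fun p hp => ⟨fun _ => (hc p).2, h2 p hp⟩⟩

theorem injOn_expandDiagonals (hm : 3 ≤ m) :
    Set.InjOn (expandDiagonals i) {T : Finset (Sym2 (ZMod m)) | ∀ q ∈ T, IsDiagonal m q} := by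
  intro S hS T hT h
  have h' := congrArg (Finset.erase · (spanTwo (m + 1) i)) h
  simp only [expandDiagonals, Finset.erase_insert (spanTwo_notMem_image i hm hS),
    Finset.erase_insert (spanTwo_notMem_image i hm hT)] at h'
  exact Finset.image_injective (Sym2.map.injective (expandMap_injective i)) h'

theorem exists_expandDiagonals_eq (hm : 3 ≤ m) {T : Finset (Sym2 (ZMod (m + 1)))}
    (hT : IsTriangulation (m + 1) T) (hi : spanTwo (m + 1) i ∈ T) :
    ∃ S : Finset (Sym2 (ZMod m)), (∀ q ∈ S, IsDiagonal m q) ∧ expandDiagonals i S = T := by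
  have hinj := Sym2.map.injective (expandMap_injective (m := m) i)
  refine ⟨(T.erase (spanTwo (m + 1) i)).preimage _ hinj.injOn, fun q hq => ?_, ?_⟩
  · rw [Finset.mem_preimage, Finset.mem_erase] at hq
    exact (isDiagonal_iff_map_expandMap i hm q).2 ⟨hT.2.1 _ hq.2, hq.1⟩
  · rw [expandDiagonals, Finset.image_preimage, Finset.filter_true_of_mem, Finset.insert_erase hi]
    intro p hp
    rw [Finset.mem_erase] at hp
    exact exists_map_expandMap_eq i fun h =>
      hT.2.2 _ hi _ hp.2 hp.1.symm (cross_spanTwo_of_mem i hm (hT.2.1 p hp.2) h)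

theorem image_expandDiagonals (hm : 3 ≤ m) {E : Set (Sym2 (ZMod (m + 1)))}
    (hei : spanTwo (m + 1) i ∈ E) :
    expandDiagonals (m := m) i '' {T' : Finset (Sym2 (ZMod (m + 1 - 1))) |
        IsTriangulation (m + 1 - 1) T' ∧ ↑T' ⊆ contractEdges (m + 1) i E} =
      {T | IsTriangulation (m + 1) T ∧ ↑T ⊆ E ∧ spanTwo (m + 1) i ∈ T} := by
  have hsub (S : Finset (Sym2 (ZMod m))) :
      ↑(expandDiagonals i S) ⊆ E ↔ ∀ q ∈ S, q.map (expandMap m i) ∈ E := by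
    simp [expandDiagonals, hei, Set.subset_def]
  ext T
  constructor
  · rintro ⟨S, ⟨hS, hSE⟩, rfl⟩
    exact ⟨(isTriangulation_expandDiagonals_iff i hm hS.2.1).2 hS,
      (hsub S).2 fun q hq => ((mem_contractEdges_iff i E q).1 (hSE hq)).1,
      Finset.mem_insert_self _ _⟩
  · rintro ⟨hT, hTE, hi⟩
    obtain ⟨S, hS, rfl⟩ := exists_expandDiagonals_eq i hm hT hi
    exact ⟨S, ⟨(isTriangulation_expandDiagonals_iff i hm hS).1 hT, fun q hq =>
      (mem_contractEdges_iff i E q).2 ⟨(hsub S).1 hTE q hq, hS q hq⟩⟩, rfl⟩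

theorem ncard_isTriangulation_spanTwo_mem (hm : 3 ≤ m) {E : Set (Sym2 (ZMod (m + 1)))}
    (hei : spanTwo (m + 1) i ∈ E) :
    Set.ncard {T : Finset (Sym2 (ZMod (m + 1))) |
        IsTriangulation (m + 1) T ∧ ↑T ⊆ E ∧ spanTwo (m + 1) i ∈ T} =
      Set.ncard {T' : Finset (Sym2 (ZMod (m + 1 - 1))) |
        IsTriangulation (m + 1 - 1) T' ∧ ↑T' ⊆ contractEdges (m + 1) i E} := by
  rw [← image_expandDiagonals i hm hei]
  exact ((injOn_expandDiagonals i hm).mono fun T hT => hT.1.2.1).ncard_image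

end expandMap

theorem ncard_isTriangulation_add (n : ℕ) [NeZero n] (E : Set (Sym2 (ZMod n)))
    (e : Sym2 (ZMod n)) :
    Set.ncard {T : Finset (Sym2 (ZMod n)) | IsTriangulation n T ∧ ↑T ⊆ E} =
      Set.ncard {T : Finset (Sym2 (ZMod n)) | IsTriangulation n T ∧ ↑T ⊆ E ∧ e ∈ T} +
        Set.ncard {T : Finset (Sym2 (ZMod n)) | IsTriangulation n T ∧ ↑T ⊆ E \ {e}} := by
  rw [← Set.ncard_union_eq _ (Set.toFinite _) (Set.toFinite _)]
  · congr 1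
    ext T
    simp only [Set.mem_ofPred_eq, Set.mem_union, Set.subset_sdiff, Set.disjoint_singleton_right,
      Finset.mem_coe]
    tauto
  · rw [Set.disjoint_left]
    rintro T ⟨-, -, he⟩ ⟨-, h⟩
    exact (h he).2 rfl

/-- The reduction argument: for `n ≥ 4` and a set `E` of diagonals containing `e_i`, the
triangulations contained in `E` that use `e_i` are counted by the triangulations of the
`(n−1)`-gon contained in the contracted edge set `E′`; consequently the total count of
triangulations contained in `E` is that number plus the number of triangulations contained in
`E ∖ {e_i}`. -/
theorem triangulation_reduction (n : ℕ) (hn : 4 ≤ n) (i : ZMod n)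
    (E : Set (Sym2 (ZMod n))) (hE : ∀ p ∈ E, IsDiagonal n p) (hei : spanTwo n i ∈ E) :
    (Set.ncard {T : Finset (Sym2 (ZMod n)) |
        IsTriangulation n T ∧ ↑T ⊆ E ∧ spanTwo n i ∈ T}
      = Set.ncard {T' : Finset (Sym2 (ZMod (n - 1))) |
          IsTriangulation (n - 1) T' ∧ ↑T' ⊆ contractEdges n i E}) ∧
    (Set.ncard {T : Finset (Sym2 (ZMod n)) | IsTriangulation n T ∧ ↑T ⊆ E}
      = Set.ncard {T' : Finset (Sym2 (ZMod (n - 1))) |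
          IsTriangulation (n - 1) T' ∧ ↑T' ⊆ contractEdges n i E}
        + Set.ncard {T : Finset (Sym2 (ZMod n)) |
            IsTriangulation n T ∧ ↑T ⊆ E \ {spanTwo n i}}) := by
  obtain ⟨m, rfl⟩ : ∃ m, n = m + 1 := ⟨n - 1, by omega⟩
  have : NeZero m := ⟨by omega⟩
  have h := ncard_isTriangulation_spanTwo_mem i (by omega) hei
  refine ⟨h, ?_⟩
  rw [ncard_isTriangulation_add (m + 1) E (spanTwo (m + 1) i), h]
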